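/- arXiv:2401.10856 — 4 statements merged into one kernel-verified Lean document; each statement's English description precedes it below -/
import Mathlib

section
/- Let X and Y be crossing mincuts. Then each of X ∩ Y, X ∖ Y, Y ∖ X, and X ∪ Y is also a mincut, and moreover C(X ∩ Y, V ∖ (X ∪ Y)) = 0 and C(X ∖ Y, Y ∖ X) = 0. -/
open Finset

variable {V : Type*} [Fintype V] [DecidableEq V]

/-- `cutW w X Y` is `C(X,Y) = Σ_{x∈X} Σ_{y∈Y} w(x,y)`. -/
def cutW (w : V → V → ℝ) (X Y : Finset V) : ℝ := ∑ x ∈ X, ∑ y ∈ Y, w x y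

/-- `C(X) := C(X, V ∖ X)`. -/
def cutVal (w : V → V → ℝ) (X : Finset V) : ℝ := cutW w X Xᶜ

/-- A cut is a nonempty proper subset of `V`. -/
def IsCut (X : Finset V) : Prop := X.Nonempty ∧ X ≠ Finset.univ

/-- A mincut is a cut of minimum weight. -/
def IsMincut (w : V → V → ℝ) (X : Finset V) : Prop :=
  IsCut X ∧ ∀ Y : Finset V, IsCut Y → cutVal w X ≤ cutVal w Y

/-- `X` and `Y` cross if `X∩Y`, `X∖Y`, `Y∖X` and `V∖(X∪Y)` are all nonempty. -/
def Crosses (X Y : Finset V) : Prop :=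
  (X ∩ Y).Nonempty ∧ (X \ Y).Nonempty ∧ (Y \ X).Nonempty ∧ ((X ∪ Y)ᶜ).Nonempty

/-- A minimal mincut of a vertex `v`: a mincut containing `v` but not the root `r`,
of minimum cardinality among all such mincuts. -/
def IsMinimalMincutOfVertex (w : V → V → ℝ) (r v : V) (X : Finset V) : Prop :=
  IsMincut w X ∧ v ∈ X ∧ r ∉ X ∧
    ∀ Y : Finset V, IsMincut w Y → v ∈ Y → r ∉ Y → X.card ≤ Y.card

/-- An edge is an unordered pair of distinct vertices with positive weight. -/
def IsEdge (w : V → V → ℝ) (u₁ u₂ : V) : Prop := u₁ ≠ u₂ ∧ 0 < w u₁ u₂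

/-- A minimal mincut of an edge `{u₁,u₂}`: a mincut containing both endpoints but not the
root `r`, of minimum cardinality among all such mincuts. -/
def IsMinimalMincutOfEdge (w : V → V → ℝ) (r u₁ u₂ : V) (X : Finset V) : Prop :=
  IsEdge w u₁ u₂ ∧ IsMincut w X ∧ u₁ ∈ X ∧ u₂ ∈ X ∧ r ∉ X ∧
    ∀ Y : Finset V, IsMincut w Y → u₁ ∈ Y → u₂ ∈ Y → r ∉ Y → X.card ≤ Y.card

theorem cutW_union_left (w : V → V → ℝ) {A B : Finset V} (Z : Finset V) (h : Disjoint A B) :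
    cutW w (A ∪ B) Z = cutW w A Z + cutW w B Z := by
  unfold cutW
  exact Finset.sum_union h

theorem cutW_symm (w : V → V → ℝ) (hsym : ∀ x y, w x y = w y x) (A B : Finset V) :
    cutW w A B = cutW w B A := by
  unfold cutW
  rw [Finset.sum_comm]
  simp only [hsym]

theorem cutW_union_right (w : V → V → ℝ) {A B : Finset V} (Z : Finset V) (h : Disjoint A B) :
    cutW w Z (A ∪ B) = cutW w Z A + cutW w Z B := by
  unfold cutW
  rw [← Finset.sum_add_distrib]
  exact Finset.sum_congr rfl fun x _ => Finset.sum_union h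

theorem cutW_nonneg (w : V → V → ℝ) (hnonneg : ∀ x y, 0 ≤ w x y) (A B : Finset V) :
    0 ≤ cutW w A B :=
  Finset.sum_nonneg fun x _ => Finset.sum_nonneg fun y _ => hnonneg x y

/-- If `X` and `Y` are crossing mincuts, then `X∩Y`, `X∖Y`, `Y∖X` and `X∪Y`
are also mincuts, and `C(X∩Y, V∖(X∪Y)) = 0` and `C(X∖Y, Y∖X) = 0`. -/
theorem crossing_mincuts
    (r : V) (w : V → V → ℝ)
    (hcard : 1 < Fintype.card V)
    (hsym : ∀ x y, w x y = w y x)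
    (hnonneg : ∀ x y, 0 ≤ w x y)
    (hdiag : ∀ x, w x x = 0)
    (X Y : Finset V)
    (hX : IsMincut w X) (hY : IsMincut w Y) (hXY : Crosses X Y) :
    IsMincut w (X ∩ Y) ∧ IsMincut w (X \ Y) ∧ IsMincut w (Y \ X) ∧ IsMincut w (X ∪ Y) ∧
      cutW w (X ∩ Y) (X ∪ Y)ᶜ = 0 ∧ cutW w (X \ Y) (Y \ X) = 0 := by
  obtain ⟨hA, hB, hD, hE⟩ := hXY
  have dAB : Disjoint (X ∩ Y) (X \ Y) := by
    rw [Finset.disjoint_left]; intro a; simp; tauto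
  have dAD : Disjoint (X ∩ Y) (Y \ X) := by
    rw [Finset.disjoint_left]; intro a; simp; tauto
  have dBD : Disjoint (X \ Y) (Y \ X) := by
    rw [Finset.disjoint_left]; intro a; simp; tauto
  have dAE : Disjoint (X ∩ Y) (X ∪ Y)ᶜ := by
    rw [Finset.disjoint_left]; intro a; simp; tauto
  have dBE : Disjoint (X \ Y) (X ∪ Y)ᶜ := by
    rw [Finset.disjoint_left]; intro a; simp; tauto
  have dDE : Disjoint (Y \ X) (X ∪ Y)ᶜ := by
    rw [Finset.disjoint_left]; intro a; simp; tauto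
  have eX : X = (X ∩ Y) ∪ (X \ Y) := by ext a; simp; tauto
  have eY : Y = (X ∩ Y) ∪ (Y \ X) := by ext a; simp; tauto
  have eXc : Xᶜ = (Y \ X) ∪ (X ∪ Y)ᶜ := by ext a; simp; tauto
  have eYc : Yᶜ = (X \ Y) ∪ (X ∪ Y)ᶜ := by ext a; simp; tauto
  have eU : X ∪ Y = ((X ∩ Y) ∪ (X \ Y)) ∪ (Y \ X) := by ext a; simp; tauto
  have eAc : (X ∩ Y)ᶜ = ((X \ Y) ∪ (Y \ X)) ∪ (X ∪ Y)ᶜ := by ext a; simp; tauto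
  have eBc : (X \ Y)ᶜ = ((X ∩ Y) ∪ (Y \ X)) ∪ (X ∪ Y)ᶜ := by ext a; simp; tauto
  have eDc : (Y \ X)ᶜ = ((X ∩ Y) ∪ (X \ Y)) ∪ (X ∪ Y)ᶜ := by ext a; simp; tauto
  have cA : IsCut (X ∩ Y) := ⟨hA, fun h => by
    obtain ⟨e, he⟩ := hE
    have := h ▸ Finset.mem_univ e
    simp at he this; tauto⟩
  have cB : IsCut (X \ Y) := ⟨hB, fun h => by
    obtain ⟨e, he⟩ := hE
    have := h ▸ Finset.mem_univ e
    simp at he this; tauto⟩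
  have cD : IsCut (Y \ X) := ⟨hD, fun h => by
    obtain ⟨e, he⟩ := hE
    have := h ▸ Finset.mem_univ e
    simp at he this; tauto⟩
  have cU : IsCut (X ∪ Y) := ⟨hA.mono (Finset.inter_subset_left.trans Finset.subset_union_left),
    fun h => by
    obtain ⟨e, he⟩ := hE
    rw [h] at he
    simp at he⟩
  have vX : cutVal w X = cutW w (X ∩ Y) (Y \ X) + cutW w (X ∩ Y) (X ∪ Y)ᶜ
      + cutW w (X \ Y) (Y \ X) + cutW w (X \ Y) (X ∪ Y)ᶜ := by
    have : cutVal w X = cutW w ((X ∩ Y) ∪ (X \ Y)) ((Y \ X) ∪ (X ∪ Y)ᶜ) := by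
      rw [← eX, ← eXc]; rfl
    rw [this, cutW_union_left w _ dAB, cutW_union_right w _ dDE, cutW_union_right w _ dDE]
    ring
  have vY : cutVal w Y = cutW w (X ∩ Y) (X \ Y) + cutW w (X ∩ Y) (X ∪ Y)ᶜ
      + cutW w (X \ Y) (Y \ X) + cutW w (Y \ X) (X ∪ Y)ᶜ := by
    have : cutVal w Y = cutW w ((X ∩ Y) ∪ (Y \ X)) ((X \ Y) ∪ (X ∪ Y)ᶜ) := by
      rw [← eY, ← eYc]; rfl
    rw [this, cutW_union_left w _ dAD, cutW_union_right w _ dBE, cutW_union_right w _ dBE,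
      cutW_symm w hsym (Y \ X) (X \ Y)]
    ring
  have vA : cutVal w (X ∩ Y) = cutW w (X ∩ Y) (X \ Y) + cutW w (X ∩ Y) (Y \ X)
      + cutW w (X ∩ Y) (X ∪ Y)ᶜ := by
    unfold cutVal
    rw [eAc, cutW_union_right w _ (Finset.disjoint_union_left.2 ⟨dBE, dDE⟩),
      cutW_union_right w _ dBD]
  have vB : cutVal w (X \ Y) = cutW w (X ∩ Y) (X \ Y) + cutW w (X \ Y) (Y \ X)
      + cutW w (X \ Y) (X ∪ Y)ᶜ := by
    unfold cutVal
    rw [eBc, cutW_union_right w _ (Finset.disjoint_union_left.2 ⟨dAE, dDE⟩),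
      cutW_union_right w _ dAD, cutW_symm w hsym (X \ Y) (X ∩ Y)]
  have vD : cutVal w (Y \ X) = cutW w (X ∩ Y) (Y \ X) + cutW w (X \ Y) (Y \ X)
      + cutW w (Y \ X) (X ∪ Y)ᶜ := by
    unfold cutVal
    rw [eDc, cutW_union_right w _ (Finset.disjoint_union_left.2 ⟨dAE, dBE⟩),
      cutW_union_right w _ dAB, cutW_symm w hsym (Y \ X) (X ∩ Y),
      cutW_symm w hsym (Y \ X) (X \ Y)]
  have vU : cutVal w (X ∪ Y) = cutW w (X ∩ Y) (X ∪ Y)ᶜ + cutW w (X \ Y) (X ∪ Y)ᶜ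
      + cutW w (Y \ X) (X ∪ Y)ᶜ := by
    rw [← cutW_union_left w _ dAB,
      ← cutW_union_left w _ (Finset.disjoint_union_left.2 ⟨dAD, dBD⟩), ← eU]
    rfl
  have n1 := cutW_nonneg w hnonneg (X ∩ Y) (X ∪ Y)ᶜ
  have n2 := cutW_nonneg w hnonneg (X \ Y) (Y \ X)
  have hxy := hX.2 Y hY.1
  have hyx := hY.2 X hX.1
  have lA := hX.2 _ cA
  have lB := hX.2 _ cB
  have lD := hX.2 _ cD
  have lU := hX.2 _ cU
  refine ⟨⟨cA, fun Z hZ => le_trans ?_ (hX.2 Z hZ)⟩, ⟨cB, fun Z hZ => le_trans ?_ (hX.2 Z hZ)⟩,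
    ⟨cD, fun Z hZ => le_trans ?_ (hX.2 Z hZ)⟩, ⟨cU, fun Z hZ => le_trans ?_ (hX.2 Z hZ)⟩, ?_, ?_⟩
    <;> linarith
end

section
/- Let v ≠ r be a vertex. If X and Y are both minimal mincuts of v (that is, each is a mincut containing v but not r, of minimum cardinality among all mincuts containing v but not r), then X = Y. In other words, if a minimal mincut of a vertex exists, it is unique. -/
open Finset

variable {V : Type*} [Fintype V] [DecidableEq V]

theorem cutVal_submod (w : V → V → ℝ) (hnonneg : ∀ x y, 0 ≤ w x y) (X Y : Finset V) :
    cutVal w (X ∩ Y) + cutVal w (X ∪ Y) ≤ cutVal w X + cutVal w Y := by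
  have key : ∀ A : Finset V, cutVal w A
      = ∑ x, ∑ y, if x ∈ A ∧ y ∉ A then w x y else 0 := by
    intro A
    unfold cutVal cutW
    rw [← Finset.sum_filter_add_sum_filter_not Finset.univ (fun x => x ∈ A)
      (fun x => ∑ y, if x ∈ A ∧ y ∉ A then w x y else 0)]
    have h2 : ∑ x with x ∉ A, (∑ y, if x ∈ A ∧ y ∉ A then w x y else 0) = 0 := by
      apply Finset.sum_eq_zero
      intro x hx
      simp at hx
      simp [hx]
    rw [h2, add_zero, Finset.filter_mem_eq_inter, Finset.univ_inter]
    apply Finset.sum_congr rfl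
    intro x hx
    simp only [hx, true_and]
    rw [← Finset.sum_filter]
    congr 1
    ext y
    simp
  simp only [key, ← Finset.sum_add_distrib]
  apply Finset.sum_le_sum
  intro x _
  apply Finset.sum_le_sum
  intro y _
  have := hnonneg x y
  by_cases h1 : x ∈ X <;> by_cases h2 : x ∈ Y <;> by_cases h3 : y ∈ X <;>
    by_cases h4 : y ∈ Y <;> simp [h1, h2, h3, h4, this]

/-- the minimal mincut of a vertex, if it exists, is unique. -/
theorem minimal_mincut_of_vertex_unique
    (r : V) (w : V → V → ℝ)
    (hcard : 1 < Fintype.card V)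
    (hsym : ∀ x y, w x y = w y x)
    (hnonneg : ∀ x y, 0 ≤ w x y)
    (hdiag : ∀ x, w x x = 0)
    (v : V) (hv : v ≠ r)
    (X Y : Finset V)
    (hX : IsMinimalMincutOfVertex w r v X)
    (hY : IsMinimalMincutOfVertex w r v Y) :
    X = Y := by
  obtain ⟨⟨⟨hXn, hXu⟩, hXm⟩, hvX, hrX, hXc⟩ := hX
  obtain ⟨⟨⟨hYn, hYu⟩, hYm⟩, hvY, hrY, hYc⟩ := hY
  have hI : IsCut (X ∩ Y) :=
    ⟨⟨v, by simp [hvX, hvY]⟩, fun h => by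
      have : r ∈ X ∩ Y := h ▸ Finset.mem_univ r
      simp [hrX] at this⟩
  have hU : IsCut (X ∪ Y) :=
    ⟨⟨v, by simp [hvX]⟩, fun h => by
      have : r ∈ X ∪ Y := h ▸ Finset.mem_univ r
      simp [hrX, hrY] at this⟩
  have hsub := cutVal_submod w hnonneg X Y
  have hIm : IsMincut w (X ∩ Y) := by
    refine ⟨hI, fun Z hZ => ?_⟩
    have h1 := hYm _ hU
    have h2 := hXm Z hZ
    linarith
  have hvI : v ∈ X ∩ Y := by simp [hvX, hvY]
  have hrI : r ∉ X ∩ Y := by simp [hrX]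
  have e1 := Finset.eq_of_subset_of_card_le Finset.inter_subset_left (hXc _ hIm hvI hrI)
  have e2 := Finset.eq_of_subset_of_card_le Finset.inter_subset_right (hYc _ hIm hvI hrI)
  exact e1.symm.trans e2
end

section
/- Let X be a mincut with r ∉ X, let v ∈ X, and let X_v be a minimal mincut of v. Then X_v ⊆ X. Consequently every mincut X with r ∉ X satisfies X = ⋃_{v∈X} X_v whenever each v ∈ X has a minimal mincut X_v. -/
open Finset

variable {V : Type*} [Fintype V] [DecidableEq V]

theorem cutVal_eq_ite (w : V → V → ℝ) (A : Finset V) :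
    cutVal w A = ∑ x, ∑ y, (if x ∈ A ∧ y ∉ A then w x y else 0) := by
  unfold cutVal cutW
  rw [← Finset.sum_filter_add_sum_filter_not Finset.univ (fun x => x ∈ A)
    (fun x => ∑ y, (if x ∈ A ∧ y ∉ A then w x y else 0))]
  have h2 : ∑ x ∈ Finset.univ.filter (fun x => ¬ x ∈ A),
      ∑ y, (if x ∈ A ∧ y ∉ A then w x y else 0) = 0 := by
    apply Finset.sum_eq_zero
    intro x hx
    have hx' : x ∉ A := (Finset.mem_filter.mp hx).2
    simp [hx']
  rw [h2, add_zero]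
  have h3 : Finset.univ.filter (fun x => x ∈ A) = A := by ext; simp
  rw [h3]
  apply Finset.sum_congr rfl
  intro x hx
  have h4 : Aᶜ = Finset.univ.filter (fun y => y ∉ A) := by ext; simp
  rw [h4, Finset.sum_filter]
  simp [hx]

/-- Submodularity of the cut function. -/
theorem cutVal_submodular (w : V → V → ℝ) (hnonneg : ∀ x y, 0 ≤ w x y) (A B : Finset V) :
    cutVal w (A ∩ B) + cutVal w (A ∪ B) ≤ cutVal w A + cutVal w B := by
  simp only [cutVal_eq_ite, ← Finset.sum_add_distrib]
  apply Finset.sum_le_sum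
  intro x _
  apply Finset.sum_le_sum
  intro y _
  have h := hnonneg x y
  by_cases h1 : x ∈ A <;> by_cases h2 : x ∈ B <;> by_cases h3 : y ∈ A <;>
    by_cases h4 : y ∈ B <;> simp [h1, h2, h3, h4, h]

/-- if `X` is a mincut with `r ∉ X` and `Xv v` is a minimal mincut of each
`v ∈ X`, then `Xv v ⊆ X` for all `v ∈ X`, and consequently `X = ⋃_{v∈X} Xv v`. -/
theorem minimal_mincut_subset_of_mincut
    (r : V) (w : V → V → ℝ)
    (hcard : 1 < Fintype.card V)
    (hsym : ∀ x y, w x y = w y x)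
    (hnonneg : ∀ x y, 0 ≤ w x y)
    (hdiag : ∀ x, w x x = 0)
    (X : Finset V) (hX : IsMincut w X) (hrX : r ∉ X)
    (Xv : V → Finset V)
    (hXv : ∀ v ∈ X, IsMinimalMincutOfVertex w r v (Xv v)) :
    (∀ v ∈ X, Xv v ⊆ X) ∧ X = X.biUnion Xv := by
  have key : ∀ v ∈ X, Xv v ⊆ X := by
    intro v hv
    obtain ⟨hM, hvM, hrM, hmin⟩ := hXv v hv
    have hsub := cutVal_submodular w hnonneg (Xv v) X
    have hU : IsCut (Xv v ∪ X) := by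
      refine ⟨⟨v, by simp [hv]⟩, fun h => ?_⟩
      have hr : r ∈ Xv v ∪ X := h ▸ Finset.mem_univ r
      simp [hrM, hrX] at hr
    have hI : IsCut (Xv v ∩ X) := by
      refine ⟨⟨v, by simp [hv, hvM]⟩, fun h => ?_⟩
      have hr : r ∈ Xv v ∩ X := h ▸ Finset.mem_univ r
      simp [hrX] at hr
    have hIM : IsMincut w (Xv v ∩ X) := by
      refine ⟨hI, fun Y hY => ?_⟩
      have h1 := hX.2 _ hU
      have h2 := hM.2 Y hY
      linarith
    have hc := hmin _ hIM (by simp [hv, hvM]) (by simp [hrX])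
    exact Finset.inter_eq_left.mp (Finset.eq_of_subset_of_card_le Finset.inter_subset_left hc)
  refine ⟨key, Finset.Subset.antisymm (fun v hv => ?_) (Finset.biUnion_subset.mpr key)⟩
  exact Finset.mem_biUnion.mpr ⟨v, hv, (hXv v hv).2.1⟩
end

section
/- Let (C₀,…,C_ℓ) be a chain and let X := C₀ ∪ ⋯ ∪ C_ℓ. Let e = {x,y} be an edge with x ∈ C₀ and y ∈ V∖X, and suppose the minimal mincut X_e of e exists. Then either (C₀ ⊆ X_e and X_e ∩ (X∖C₀) = ∅) or X ⊆ X_e. The symmetric statement holds for edges leaving C_ℓ. -/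
open Finset

variable {V : Type*} [Fintype V] [DecidableEq V]

/-- Union of the members of a chain. -/
def chainUnion (C : List (Finset V)) : Finset V := C.foldr (· ∪ ·) ∅

/-- `X ⊆ V∖{r}` has a certificate if it is the minimal mincut of some vertex,
the minimal mincut of some edge, or the union of a chain, where a chain is a sequence
`(C₀,…,C_ℓ)` (`ℓ ≥ 1`) of pairwise disjoint nonempty subsets of `V∖{r}` such that every
`C_i` has a certificate and each `C_i ∪ C_{i+1}` is the minimal mincut of some edge. -/
inductive HasCert (w : V → V → ℝ) (r : V) : Finset V → Prop
  | vertex {v : V} {X : Finset V} : IsMinimalMincutOfVertex w r v X → HasCert w r X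
  | edge {u₁ u₂ : V} {X : Finset V} : IsMinimalMincutOfEdge w r u₁ u₂ X → HasCert w r X
  | chain {C : List (Finset V)} :
      2 ≤ C.length →
      (∀ A ∈ C, A.Nonempty) →
      (∀ A ∈ C, r ∉ A) →
      C.Pairwise (fun A B => Disjoint A B) →
      (∀ A ∈ C, HasCert w r A) →
      (∀ i (h : i + 1 < C.length),
        ∃ u₁ u₂, IsMinimalMincutOfEdge w r u₁ u₂
          (C.get ⟨i, Nat.lt_of_succ_lt h⟩ ∪ C.get ⟨i + 1, h⟩)) →
      HasCert w r (chainUnion C)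

/-- `(C₀,…,C_ℓ)` with `ℓ ≥ 1` is a chain. -/
def IsMincutChain (w : V → V → ℝ) (r : V) (C : List (Finset V)) : Prop :=
  2 ≤ C.length ∧
  (∀ A ∈ C, A.Nonempty) ∧
  (∀ A ∈ C, r ∉ A) ∧
  C.Pairwise (fun A B => Disjoint A B) ∧
  (∀ A ∈ C, HasCert w r A) ∧
  (∀ i (h : i + 1 < C.length),
    ∃ u₁ u₂, IsMinimalMincutOfEdge w r u₁ u₂
      (C.get ⟨i, Nat.lt_of_succ_lt h⟩ ∪ C.get ⟨i + 1, h⟩))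

/-- A subchain is a consecutive subsequence of a chain or of its reversal. -/
def IsSubchain (D C : List (Finset V)) : Prop := D <:+: C ∨ D <:+: C.reverse

/-- A maximal chain is a chain that is not a subchain of any strictly longer chain. -/
def IsMaximalMincutChain (w : V → V → ℝ) (r : V) (C : List (Finset V)) : Prop :=
  IsMincutChain w r C ∧
    ¬ ∃ D : List (Finset V), IsMincutChain w r D ∧ C.length < D.length ∧ IsSubchain C D

/-- `lam` is the minimum weight of a cut. -/
def IsMincutValue (w : V → V → ℝ) (lam : ℝ) : Prop :=
  (∃ X : Finset V, IsCut X ∧ cutVal w X = lam) ∧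
  ∀ X : Finset V, IsCut X → lam ≤ cutVal w X

theorem cutVal_eq_ind (w : V → V → ℝ) (X : Finset V) :
    cutVal w X = ∑ a, ∑ b, if a ∈ X ∧ b ∉ X then w a b else 0 := by
  unfold cutVal cutW
  rw [← Finset.sum_filter_add_sum_filter_not Finset.univ (· ∈ X)
    (fun a => ∑ b, if a ∈ X ∧ b ∉ X then w a b else 0)]
  have h2 : ∑ a ∈ Finset.univ.filter (fun a => ¬ a ∈ X),
      (∑ b, if a ∈ X ∧ b ∉ X then w a b else 0) = 0 := by
    apply Finset.sum_eq_zero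
    intro a ha
    have : a ∉ X := by simpa using ha
    simp [this]
  rw [h2, add_zero]
  have h3 : Finset.univ.filter (fun a => a ∈ X) = X := by ext; simp
  rw [h3]
  apply Finset.sum_congr rfl
  intro a ha
  have h4 : Xᶜ = Finset.univ.filter (fun b => b ∉ X) := by ext; simp
  rw [h4, Finset.sum_filter]
  simp [ha]

theorem cutVal_compl (w : V → V → ℝ) (hsym : ∀ x y, w x y = w y x) (X : Finset V) :
    cutVal w Xᶜ = cutVal w X := by
  unfold cutVal cutW
  rw [compl_compl, Finset.sum_comm]
  simp_rw [hsym]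

theorem IsMincut.compl {w : V → V → ℝ} (hsym : ∀ x y, w x y = w y x) {X : Finset V}
    (h : IsMincut w X) : IsMincut w Xᶜ := by
  refine ⟨⟨?_, ?_⟩, ?_⟩
  · rw [Finset.nonempty_iff_ne_empty, Ne, Finset.compl_eq_empty_iff]
    exact h.1.2
  · rw [Ne, Finset.compl_eq_univ_iff]
    exact h.1.1.ne_empty
  · rw [cutVal_compl w hsym]
    exact h.2

theorem cutVal_uncross (w : V → V → ℝ) (X Y : Finset V) :
    cutVal w X + cutVal w Y = cutVal w (X ∩ Y) + cutVal w (X ∪ Y) +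
      ∑ a, ∑ b, if (a ∈ X ∧ a ∉ Y ∧ b ∈ Y ∧ b ∉ X) ∨ (a ∈ Y ∧ a ∉ X ∧ b ∈ X ∧ b ∉ Y)
        then w a b else 0 := by
  simp only [cutVal_eq_ind, ← Finset.sum_add_distrib]
  apply Finset.sum_congr rfl
  intro a _
  apply Finset.sum_congr rfl
  intro b _
  by_cases h1 : a ∈ X <;> by_cases h2 : a ∈ Y <;> by_cases h3 : b ∈ X <;>
    by_cases h4 : b ∈ Y <;> simp [h1, h2, h3, h4]

theorem mincut_uncross {w : V → V → ℝ} (hnonneg : ∀ x y, 0 ≤ w x y) {X Y : Finset V}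
    (hX : IsMincut w X) (hY : IsMincut w Y) (hi : (X ∩ Y).Nonempty) {r : V}
    (hrX : r ∉ X) (hrY : r ∉ Y) :
    IsMincut w (X ∩ Y) ∧ IsMincut w (X ∪ Y) ∧
      ∀ a b, a ∈ X → a ∉ Y → b ∈ Y → b ∉ X → w a b = 0 := by
  have hci : IsCut (X ∩ Y) := ⟨hi, fun h => by
    have := Finset.mem_univ r
    rw [← h] at this
    exact hrX (Finset.mem_inter.1 this).1⟩
  have hcu : IsCut (X ∪ Y) := ⟨hX.1.1.mono Finset.subset_union_left, fun h => by
    have := Finset.mem_univ r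
    rw [← h] at this
    exact (Finset.mem_union.1 this).elim hrX hrY⟩
  have key := cutVal_uncross w X Y
  have hterm : ∀ a b : V, (0:ℝ) ≤ if (a ∈ X ∧ a ∉ Y ∧ b ∈ Y ∧ b ∉ X) ∨
      (a ∈ Y ∧ a ∉ X ∧ b ∈ X ∧ b ∉ Y) then w a b else 0 := by
    intro a b
    split_ifs
    · exact hnonneg a b
    · exact le_rfl
  set S := ∑ a, ∑ b, if (a ∈ X ∧ a ∉ Y ∧ b ∈ Y ∧ b ∉ X) ∨ (a ∈ Y ∧ a ∉ X ∧ b ∈ X ∧ b ∉ Y)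
        then w a b else 0 with hS
  have hS0 : 0 ≤ S := Finset.sum_nonneg fun a _ => Finset.sum_nonneg fun b _ => hterm a b
  have e1 := hX.2 _ hci
  have e2 := hX.2 _ hcu
  have e3 := hX.2 _ hY.1
  have e4 := hY.2 _ hX.1
  have e5 := hY.2 _ hci
  refine ⟨⟨hci, fun Z hZ => ?_⟩, ⟨hcu, fun Z hZ => ?_⟩, ?_⟩
  · have := hX.2 _ hZ
    linarith
  · have := hX.2 _ hZ
    linarith
  · intro a b ha ha' hb hb'
    have hz : S = 0 := by linarith
    rw [hS, Finset.sum_eq_zero_iff_of_nonneg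
      (fun a _ => Finset.sum_nonneg fun b _ => hterm a b)] at hz
    have := hz a (Finset.mem_univ a)
    rw [Finset.sum_eq_zero_iff_of_nonneg (fun b _ => hterm a b)] at this
    have := this b (Finset.mem_univ b)
    simpa [ha, ha', hb, hb'] using this

/-- The other uncrossing: for crossing mincuts the difference is a mincut, and there is no
edge between `X ∩ Y` and `(X ∪ Y)ᶜ`. -/
theorem mincut_uncross_diff {w : V → V → ℝ} (hsym : ∀ x y, w x y = w y x)
    (hnonneg : ∀ x y, 0 ≤ w x y) {X Y : Finset V}
    (hX : IsMincut w X) (hY : IsMincut w Y) (hd : (X \ Y).Nonempty) {z : V}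
    (hzX : z ∉ X) (hzY : z ∈ Y) :
    IsMincut w (X \ Y) ∧
      ∀ a b, a ∈ X → a ∈ Y → b ∉ X → b ∉ Y → w a b = 0 := by
  have hi : (X ∩ Yᶜ).Nonempty := by
    rwa [← Finset.sdiff_eq_inter_compl]
  obtain ⟨h1, -, h3⟩ := mincut_uncross hnonneg hX (hY.compl hsym) hi hzX (by simpa using hzY)
  refine ⟨by rwa [Finset.sdiff_eq_inter_compl], ?_⟩
  intro a b ha ha' hb hb'
  exact h3 a b ha (by simpa using ha') (by simpa using hb') hb

theorem chainUnion_mincut {w : V → V → ℝ} (hnonneg : ∀ x y, 0 ≤ w x y) {r : V}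
    (l : List (Finset V)) : ∀ a b : Finset V,
    (∀ A ∈ a :: b :: l, A.Nonempty) → (∀ A ∈ a :: b :: l, r ∉ A) →
    List.IsChain (fun A B => IsMincut w (A ∪ B)) (a :: b :: l) →
    IsMincut w (chainUnion (a :: b :: l)) ∧ r ∉ chainUnion (a :: b :: l) := by
  induction l with
  | nil =>
    intro a b hn hr hc
    simp only [List.isChain_cons_cons] at hc
    simp only [List.mem_cons, forall_eq_or_imp] at hr
    simp [chainUnion, hc.1, hr.1, hr.2.1]
  | cons c l ih =>
    intro a b hn hr hc
    rw [List.isChain_cons_cons] at hc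
    obtain ⟨h1, h2⟩ := ih b c (fun A hA => hn A (List.mem_cons_of_mem _ hA))
      (fun A hA => hr A (List.mem_cons_of_mem _ hA)) hc.2
    have ha : r ∉ a := hr a (by simp)
    have hb : r ∉ b := hr b (by simp)
    have hbn : b.Nonempty := hn b (by simp)
    have e : chainUnion (a :: b :: c :: l) = (a ∪ b) ∪ chainUnion (b :: c :: l) := by
      simp only [chainUnion, List.foldr_cons]
      ext; simp
    refine ⟨?_, ?_⟩
    · rw [e]
      refine (mincut_uncross hnonneg hc.1 h1 ?_ (r := r) (by simp [ha, hb]) h2).2.1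
      obtain ⟨z, hz⟩ := hbn
      exact ⟨z, by simp [chainUnion, hz]⟩
    · rw [e]
      simp only [Finset.mem_union, not_or]
      exact ⟨⟨ha, hb⟩, h2⟩

theorem HasCert.mincut {w : V → V → ℝ} (hnonneg : ∀ x y, 0 ≤ w x y) {r : V} {X : Finset V}
    (h : HasCert w r X) : IsMincut w X := by
  cases h with
  | vertex h => exact h.1
  | edge h => exact h.2.1
  | @chain C h2 hn hr hp hc he =>
    match C, h2 with
    | a :: b :: l, _ =>
      refine (chainUnion_mincut hnonneg l a b hn hr ?_).1
      rw [List.isChain_iff_getElem]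
      intro i hi
      obtain ⟨u, v, huv⟩ := he i hi
      exact huv.2.1

theorem chain_core {w : V → V → ℝ} {r : V} (hsym : ∀ x y, w x y = w y x)
    (hnonneg : ∀ x y, 0 ≤ w x y) {A B T : Finset V}
    (hA : IsMincut w A) (hB : IsMincut w B) (hT : IsMincut w T)
    (hAB : Disjoint A B) (hAT : Disjoint A T) (hBT : B ⊆ T)
    (hrA : r ∉ A) (hrT : r ∉ T) {u v : V} (he : IsMinimalMincutOfEdge w r u v (A ∪ B))
    {x y : V} {Xe : Finset V} (hx : x ∈ A) (hyA : y ∉ A) (hyT : y ∉ T)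
    (hXe : IsMinimalMincutOfEdge w r x y Xe) :
    (A ⊆ Xe ∧ Disjoint Xe T) ∨ A ∪ T ⊆ Xe := by
  obtain ⟨-, hXm, hxX, hyX, hrX, hXmin⟩ := hXe
  have hyB : y ∉ B := fun h => hyT (hBT h)
  have hrB : r ∉ B := fun h => hrT (hBT h)
  have hxB : x ∉ B := Finset.disjoint_left.1 hAB hx
  have hxT : x ∉ T := Finset.disjoint_left.1 hAT hx
  have hAX : A ⊆ Xe := by
    by_contra hnA
    obtain ⟨z, hzA, hzX⟩ := Finset.not_subset.1 hnA
    -- wlog the edge goes from A to B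
    have main : ∀ u v, u ∈ A → v ∈ B → 0 < w u v →
        (∀ Y : Finset V, IsMincut w Y → u ∈ Y → v ∈ Y → r ∉ Y → (A ∪ B).card ≤ Y.card) →
        IsMincut w (A ∪ B) → False := by
      intro u v hu hv hw hmin hZ
      have hvA : v ∉ A := Finset.disjoint_right.1 hAB hv
      obtain ⟨m1, -, z1⟩ := mincut_uncross hnonneg hA hXm
        ⟨x, Finset.mem_inter.2 ⟨hx, hxX⟩⟩ hrA hrX
      obtain ⟨-, z2⟩ := mincut_uncross_diff hsym hnonneg hA hXm
        ⟨z, Finset.mem_sdiff.2 ⟨hzA, hzX⟩⟩ hyA hyX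
      obtain ⟨m3, -, -⟩ := mincut_uncross hnonneg hZ hXm (r := r)
        ⟨x, by simp [hx, hxX]⟩ (by simp [hrA, hrB]) hrX
      obtain ⟨m4, -⟩ := mincut_uncross_diff hsym hnonneg hZ hXm (z := y)
        ⟨z, by simp [hzA, hzX]⟩ (by simp [hyA, hyB]) hyX
      by_cases huX : u ∈ Xe <;> by_cases hvX : v ∈ Xe
      · have := hmin _ m3 (by simp [hu, huX]) (by simp [hv, hvX]) (by simp [hrX])
        have hlt : ((A ∪ B) ∩ Xe).card < (A ∪ B).card := by
          apply Finset.card_lt_card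
          refine Finset.ssubset_iff_subset_ne.2 ⟨Finset.inter_subset_left, fun h => ?_⟩
          have : z ∈ (A ∪ B) ∩ Xe := by rw [h]; simp [hzA]
          exact hzX (Finset.mem_inter.1 this).2
        omega
      · have := z2 u v hu huX hvA hvX
        linarith
      · have := z1 u v hu huX hvX hvA
        linarith
      · have := hmin _ m4 (by simp [hu, huX]) (by simp [hv, hvX]) (by simp [hrA, hrB])
        have hlt : ((A ∪ B) \ Xe).card < (A ∪ B).card := by
          apply Finset.card_lt_card
          refine Finset.ssubset_iff_subset_ne.2 ⟨Finset.sdiff_subset, fun h => ?_⟩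
          have : x ∈ (A ∪ B) \ Xe := by rw [h]; simp [hx]
          exact (Finset.mem_sdiff.1 this).2 hxX
        omega
    obtain ⟨⟨-, hw⟩, hZ, hu, hv, -, hmin⟩ := he
    have hcard := Finset.card_union_of_disjoint hAB
    have hAc := hA.1.1.card_pos
    have hBc := hB.1.1.card_pos
    rcases Finset.mem_union.1 hu with hu | hu <;> rcases Finset.mem_union.1 hv with hv | hv
    · have := hmin A hA hu hv hrA
      omega
    · exact main u v hu hv hw hmin hZ
    · exact main v u hv hu (by rwa [hsym]) (fun Y h1 h2 h3 => hmin Y h1 h3 h2) hZ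
    · have := hmin B hB hu hv hrB
      omega
  by_cases hd : Disjoint Xe T
  · exact Or.inl ⟨hAX, hd⟩
  right
  apply Finset.union_subset hAX
  by_contra hn
  obtain ⟨z, hzT, hzX⟩ := Finset.not_subset.1 hn
  obtain ⟨t, htX, htT⟩ := Finset.not_disjoint_iff.1 hd
  obtain ⟨m, -⟩ := mincut_uncross_diff hsym hnonneg hXm hT
    ⟨x, Finset.mem_sdiff.2 ⟨hxX, hxT⟩⟩ hzX hzT
  have := hXmin _ m (by simp [hxX, hxT]) (by simp [hyX, hyT]) (by simp [hrX])
  have hlt : (Xe \ T).card < Xe.card := by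
    apply Finset.card_lt_card
    refine Finset.ssubset_iff_subset_ne.2 ⟨Finset.sdiff_subset, fun h => ?_⟩
    rw [← h] at htX
    exact (Finset.mem_sdiff.1 htX).2 htT
  omega

theorem mem_chainUnion (C : List (Finset V)) (z : V) :
    z ∈ chainUnion C ↔ ∃ A ∈ C, z ∈ A := by
  induction C with
  | nil => simp [chainUnion]
  | cons a l ih =>
    have : chainUnion (a :: l) = a ∪ chainUnion l := rfl
    rw [this]
    simp [ih]

theorem chain_head {w : V → V → ℝ} {r : V} (hsym : ∀ x y, w x y = w y x)
    (hnonneg : ∀ x y, 0 ≤ w x y) (C : List (Finset V)) (hne : C ≠ [])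
    (h2 : 2 ≤ C.length) (hn : ∀ A ∈ C, A.Nonempty) (hr : ∀ A ∈ C, r ∉ A)
    (hp : C.Pairwise (fun A B => Disjoint A B)) (hc : ∀ A ∈ C, IsMincut w A)
    (he : C.IsChain (fun A B => ∃ u₁ u₂, IsMinimalMincutOfEdge w r u₁ u₂ (A ∪ B)))
    (x y : V) (Xe : Finset V) (hx : x ∈ C.head hne) (hy : y ∉ chainUnion C)
    (hXe : IsMinimalMincutOfEdge w r x y Xe) :
    (C.head hne ⊆ Xe ∧ Disjoint Xe (chainUnion C \ C.head hne)) ∨ chainUnion C ⊆ Xe := by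
  match C, h2 with
  | a :: b :: l, _ =>
    have hu : chainUnion (a :: b :: l) = a ∪ chainUnion (b :: l) := rfl
    simp only [List.head_cons] at hx ⊢
    have hT : IsMincut w (chainUnion (b :: l)) := by
      cases l with
      | nil => simpa [chainUnion] using hc b (by simp)
      | cons c l =>
        refine (chainUnion_mincut hnonneg (r := r) l b c
          (fun A hA => hn A (List.mem_cons_of_mem _ hA))
          (fun A hA => hr A (List.mem_cons_of_mem _ hA)) ?_).1
        refine (List.isChain_cons_cons.1 he).2.imp ?_
        rintro A B ⟨u, v, h⟩
        exact h.2.1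
    have hrT : r ∉ chainUnion (b :: l) := by
      rw [mem_chainUnion]
      rintro ⟨A, hA, h⟩
      exact hr A (List.mem_cons_of_mem _ hA) h
    have hdisj : ∀ B ∈ b :: l, Disjoint a B := (List.pairwise_cons.1 hp).1
    have hAT : Disjoint a (chainUnion (b :: l)) := by
      rw [Finset.disjoint_left]
      intro z hz hzT
      obtain ⟨A, hA, h⟩ := (mem_chainUnion _ _).1 hzT
      exact Finset.disjoint_left.1 (hdisj A hA) hz h
    obtain ⟨u, v, huv⟩ := (List.isChain_cons_cons.1 he).1
    rw [hu, Finset.mem_union, not_or] at hy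
    have := chain_core hsym hnonneg (hc a (by simp)) (hc b (by simp)) hT
      (hdisj b (by simp)) hAT (by intro z hz; exact (mem_chainUnion _ _).2 ⟨b, by simp, hz⟩)
      (hr a (by simp)) hrT huv hx hy.1 hy.2 hXe
    rw [hu]
    refine this.imp (fun h => ⟨h.1, h.2.mono_right ?_⟩) id
    intro z hz
    simp only [Finset.mem_sdiff, Finset.mem_union] at hz
    tauto

/-- for a chain with union `X` and an edge `e = {x,y}` with `x ∈ C₀`
(resp. `x ∈ C_ℓ`) and `y ∉ X` whose minimal mincut `Xe` exists, either `C₀ ⊆ Xe` and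
`Xe ∩ (X ∖ C₀) = ∅`, or `X ⊆ Xe` (resp. the symmetric statement for `C_ℓ`). -/
theorem chain_end_edge_minimal_mincut
    (r : V) (w : V → V → ℝ)
    (hcard : 1 < Fintype.card V)
    (hsym : ∀ x y, w x y = w y x)
    (hnonneg : ∀ x y, 0 ≤ w x y)
    (hdiag : ∀ x, w x x = 0)
    (C : List (Finset V)) (hC : IsMincutChain w r C) (hne : C ≠ []) :
    (∀ x y : V, ∀ Xe : Finset V, x ∈ C.head hne → y ∉ chainUnion C →
      IsMinimalMincutOfEdge w r x y Xe →
      (C.head hne ⊆ Xe ∧ Disjoint Xe (chainUnion C \ C.head hne)) ∨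
        chainUnion C ⊆ Xe) ∧
    (∀ x y : V, ∀ Xe : Finset V, x ∈ C.getLast hne → y ∉ chainUnion C →
      IsMinimalMincutOfEdge w r x y Xe →
      (C.getLast hne ⊆ Xe ∧ Disjoint Xe (chainUnion C \ C.getLast hne)) ∨
        chainUnion C ⊆ Xe) := by
  obtain ⟨h2, hn, hr, hp, hc, he⟩ := hC
  have hm : ∀ A ∈ C, IsMincut w A := fun A hA => (hc A hA).mincut hnonneg
  have hch : C.IsChain (fun A B => ∃ u₁ u₂, IsMinimalMincutOfEdge w r u₁ u₂ (A ∪ B)) := by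
    rw [List.isChain_iff_getElem]
    intro i hi
    exact he i hi
  refine ⟨chain_head hsym hnonneg C hne h2 hn hr hp hm hch, ?_⟩
  have hne' : C.reverse ≠ [] := by simpa using hne
  have hU : chainUnion C.reverse = chainUnion C := by
    ext z
    simp [mem_chainUnion]
  have := chain_head hsym hnonneg C.reverse hne' (by simpa using h2) (by simpa using hn)
    (by simpa using hr)
    (by rw [List.pairwise_reverse]; exact hp.imp fun h => h.symm) (by simpa using hm)
    (by
      rw [List.isChain_reverse]
      refine hch.imp ?_
      rintro A B ⟨u, v, h⟩
      exact ⟨u, v, by rwa [Finset.union_comm]⟩)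
  simpa only [hU, List.head_reverse] using this
end
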